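/- arXiv:2503.13727 — 2 statements merged into one kernel-verified Lean document; each statement's English description precedes it below -/
import Mathlib

section
/- If X ⊆ ℕ is loquaciously high for paths, then every Π¹₁ subset of ℕ is c.e. in X; in particular, the set WF = {e : T_e is well-founded} is c.e. in X. -/
namespace CFT

open Nat.Partrec (Code)

/-- Relativized partial recursive functions: `f` is partial recursive in the
(total) oracle `O : ℕ → ℕ`.  This mirrors Mathlib's `Nat.Partrec`, with an
extra constructor for the oracle. -/
inductive RecursiveIn (O : ℕ → ℕ) : (ℕ →. ℕ) → Prop
  | zero : RecursiveIn O (pure 0)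
  | succ : RecursiveIn O Nat.succ
  | left : RecursiveIn O ↑fun n : ℕ => n.unpair.1
  | right : RecursiveIn O ↑fun n : ℕ => n.unpair.2
  | oracle : RecursiveIn O ↑O
  | pair {f g} : RecursiveIn O f → RecursiveIn O g →
      RecursiveIn O fun n => Nat.pair <$> f n <*> g n
  | comp {f g} : RecursiveIn O f → RecursiveIn O g →
      RecursiveIn O fun n => g n >>= f
  | prec {f g} : RecursiveIn O f → RecursiveIn O g →
      RecursiveIn O (Nat.unpaired fun a n =>
        n.rec (f a) fun y IH => do let i ← IH; g (Nat.pair a (Nat.pair y i)))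
  | rfind {f} : RecursiveIn O f →
      RecursiveIn O fun a => Nat.rfind fun n => (fun m => m = 0) <$> f (Nat.pair a n)

/-- Partial functions between `Primcodable` types that are partial recursive in
the oracle `O`. -/
def PartrecIn (O : ℕ → ℕ) {α σ : Type} [Primcodable α] [Primcodable σ] (f : α →. σ) : Prop :=
  RecursiveIn O fun n =>
    Part.bind (Part.ofOption (Encodable.decode (α := α) n)) fun a => (f a).map Encodable.encode

/-- Total functions between `Primcodable` types that are computable in the oracle `O`. -/
def ComputableIn (O : ℕ → ℕ) {α σ : Type} [Primcodable α] [Primcodable σ] (f : α → σ) : Prop :=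
  PartrecIn O (f : α →. σ)

open Classical in
/-- The characteristic function of a set of naturals. -/
noncomputable def chi (A : Set ℕ) : ℕ → ℕ := fun n => if n ∈ A then 1 else 0

/-- `A` is computably enumerable in (the characteristic function of) `X`. -/
def CEIn (X : Set ℕ) (A : Set ℕ) : Prop :=
  ∃ f : ℕ →. ℕ, PartrecIn (chi X) f ∧ ∀ n, n ∈ A ↔ (f n).Dom

/-- The `e`-th partial computable function `ℕ →. ℕ`. -/
def codeFn (e : ℕ) : ℕ →. ℕ := (Denumerable.ofNat Code e).eval

/-! ### Trees on ℕ -/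

def PrefixClosed (T : Set (List ℕ)) : Prop := ∀ l ∈ T, ∀ l' : List ℕ, l' <+: l → l' ∈ T

/-- Index `e` decides a (prefix-closed) tree on `ℕ`. -/
def DecidesTree (e : ℕ) : Prop :=
  (∀ n, (codeFn e n).Dom) ∧
    PrefixClosed {l : List ℕ | codeFn e (Encodable.encode l) = Part.some 1}

open Classical in
/-- The standard enumeration of computable trees on ℕ; indices that do not
decide a tree denote the empty tree. -/
noncomputable def treeAt (e : ℕ) : Set (List ℕ) :=
  if DecidesTree e then {l : List ℕ | codeFn e (Encodable.encode l) = Part.some 1} else ∅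

/-- `f` is a path through the tree `T`: every finite initial segment
`[f 0, …, f (k-1)]` is in `T`. -/
def IsPath (T : Set (List ℕ)) (f : ℕ → ℕ) : Prop := ∀ k, (List.range k).map f ∈ T

def IllFounded (T : Set (List ℕ)) : Prop := ∃ f, IsPath T f

/-- The set of indices of well-founded computable trees. -/
def WF : Set ℕ := {e | ¬ IllFounded (treeAt e)}

/-- `T` is a computable tree (prefix-closed and decided by a total computable function). -/
def ComputableTree (T : Set (List ℕ)) : Prop :=
  PrefixClosed T ∧ ∃ χ : List ℕ → Bool, Computable χ ∧ ∀ l, l ∈ T ↔ χ l = true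

/-! ### Highness notions for paths -/

def HighForPaths (X : Set ℕ) : Prop :=
  ∀ T : Set (List ℕ), ComputableTree T → IllFounded T →
    ∃ f : ℕ → ℕ, ComputableIn (chi X) f ∧ IsPath T f

def LoqHighForPaths (X : Set ℕ) : Prop :=
  ∃ F : ℕ × ℕ → ℕ, ComputableIn (chi X) F ∧
    ∀ e, IllFounded (treeAt e) → IsPath (treeAt e) fun n => F (e, n)

def UnifHighForPaths (X : Set ℕ) : Prop :=
  ∃ F : ℕ × ℕ →. ℕ, PartrecIn (chi X) F ∧
    ∀ e, IllFounded (treeAt e) →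
      ∃ g : ℕ → ℕ, IsPath (treeAt e) g ∧ ∀ n, F (e, n) = Part.some (g n)

def RetHighForPaths (X : Set ℕ) : Prop :=
  ∃ F : ℕ × ℕ →. ℕ, PartrecIn (chi X) F ∧
    (∀ e, IllFounded (treeAt e) →
      ∃ g : ℕ → ℕ, IsPath (treeAt e) g ∧ ∀ n, F (e, n) = Part.some (g n)) ∧
    (∀ e, ¬ IllFounded (treeAt e) → ∀ n, ¬ (F (e, n)).Dom)

/-! ### Σ¹₁ and Π¹₁ sets -/

def Sigma11 (A : Set ℕ) : Prop :=
  ∃ R : ℕ → List ℕ → Bool, Computable₂ R ∧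
    ∀ n, n ∈ A ↔ ∃ f : ℕ → ℕ, ∀ k, R n ((List.range k).map f) = true

def Pi11 (A : Set ℕ) : Prop := Sigma11 Aᶜ

/-! ### Linear orders -/

/-- A (presentation of a) linear order: a domain `D ⊆ ℕ` and a strict order
relation on it. -/
structure LinOrd where
  dom : Set ℕ
  lt : ℕ → ℕ → Prop

/-- `L` really is a strict linear order on its domain. -/
def LinOrd.IsValid (L : LinOrd) : Prop :=
  (∀ a b, L.lt a b → a ∈ L.dom ∧ b ∈ L.dom) ∧
  (∀ a, ¬ L.lt a a) ∧
  (∀ a b c, L.lt a b → L.lt b c → L.lt a c) ∧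
  (∀ a ∈ L.dom, ∀ b ∈ L.dom, a = b ∨ L.lt a b ∨ L.lt b a)

def linOrdOfCodes (n : ℕ) : LinOrd :=
  ⟨{a | codeFn n.unpair.1 a = Part.some 1},
   fun a b => codeFn n.unpair.2 (Nat.pair a b) = Part.some 1⟩

def DecidesLinOrd (n : ℕ) : Prop :=
  (∀ m, (codeFn n.unpair.1 m).Dom) ∧ (∀ m, (codeFn n.unpair.2 m).Dom) ∧
    (linOrdOfCodes n).IsValid

open Classical in
/-- The standard enumeration of computable linear orders; indices that do not
decide a linear order denote the empty order. -/
noncomputable def linOrdAt (n : ℕ) : LinOrd :=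
  if DecidesLinOrd n then linOrdOfCodes n else ⟨∅, fun _ _ => False⟩

def IsDescSeq (L : LinOrd) (f : ℕ → ℕ) : Prop :=
  ∀ i, f i ∈ L.dom ∧ L.lt (f (i + 1)) (f i)

def LinOrd.IllFounded (L : LinOrd) : Prop := ∃ f, IsDescSeq L f

/-- A tight descending sequence: a descending sequence that gets below every
descending sequence. -/
def IsTightDescSeq (L : LinOrd) (f : ℕ → ℕ) : Prop :=
  IsDescSeq L f ∧ ∀ g, IsDescSeq L g → ∀ n, ∃ m, L.lt (f m) (g n)

/-- `L` is a computable linear order. -/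
def ComputableLinOrd (L : LinOrd) : Prop :=
  L.IsValid ∧
  (∃ χ : ℕ → Bool, Computable χ ∧ ∀ a, a ∈ L.dom ↔ χ a = true) ∧
  (∃ χ : ℕ → ℕ → Bool, Computable₂ χ ∧ ∀ a b, L.lt a b ↔ χ a b = true)

def LoqHighForDS (X : Set ℕ) : Prop :=
  ∃ g : ℕ × ℕ → ℕ, ComputableIn (chi X) g ∧
    ∀ n, (linOrdAt n).IllFounded → IsDescSeq (linOrdAt n) fun k => g (n, k)

def HighForTightDS (X : Set ℕ) : Prop :=
  ∀ L : LinOrd, ComputableLinOrd L → L.IllFounded →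
    ∃ f : ℕ → ℕ, ComputableIn (chi X) f ∧ IsTightDescSeq L f

def UnifHighForTightDS (X : Set ℕ) : Prop :=
  ∃ F : ℕ × ℕ →. ℕ, PartrecIn (chi X) F ∧
    ∀ n, (linOrdAt n).IllFounded →
      ∃ g : ℕ → ℕ, IsTightDescSeq (linOrdAt n) g ∧ ∀ k, F (n, k) = Part.some (g k)

/-! ### Binary trees -/

def PrefixClosedB (B : Set (List Bool)) : Prop := ∀ l ∈ B, ∀ l' : List Bool, l' <+: l → l' ∈ B

def DecidesBTree (e : ℕ) : Prop :=
  (∀ n, (codeFn e n).Dom) ∧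
    PrefixClosedB {l : List Bool | codeFn e (Encodable.encode l) = Part.some 1}

open Classical in
/-- The standard enumeration of computable binary trees; indices that do not
decide a binary tree denote the full binary tree. -/
noncomputable def bTreeAt (e : ℕ) : Set (List Bool) :=
  if DecidesBTree e then {l : List Bool | codeFn e (Encodable.encode l) = Part.some 1}
  else Set.univ

def BInfinite (B : Set (List Bool)) : Prop := ∀ k, ∃ l ∈ B, l.length = k

def IsBPath (B : Set (List Bool)) (p : ℕ → Bool) : Prop := ∀ k, (List.range k).map p ∈ B


theorem RecursiveIn.of_eq {O : ℕ → ℕ} {f g : ℕ →. ℕ} (hf : RecursiveIn O f)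
    (h : ∀ n, f n = g n) : RecursiveIn O g :=
  (funext h : f = g) ▸ hf

theorem RecursiveIn.of_partrec {O : ℕ → ℕ} {f : ℕ →. ℕ} (hf : Nat.Partrec f) :
    RecursiveIn O f := by
  induction hf with
  | zero => exact .zero
  | succ => exact .succ
  | left => exact .left
  | right => exact .right
  | pair _ _ hf hg => exact .pair hf hg
  | comp _ _ hf hg => exact .comp hf hg
  | prec _ _ hf hg => exact .prec hf hg
  | rfind _ hf => exact .rfind hf

theorem RecursiveIn.of_computable {O : ℕ → ℕ} {f : ℕ → ℕ} (hf : Computable f) :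
    RecursiveIn O f :=
  .of_partrec (Partrec.nat_iff.1 hf)

theorem RecursiveIn.comp_total {O f g : ℕ → ℕ} (hf : RecursiveIn O f) (hg : RecursiveIn O g) :
    RecursiveIn O fun n => Part.some (f (g n)) :=
  (hf.comp hg).of_eq fun _ => Part.bind_some _ _

theorem RecursiveIn.pair_total {O f g : ℕ → ℕ} (hf : RecursiveIn O f) (hg : RecursiveIn O g) :
    RecursiveIn O fun n => Part.some (Nat.pair (f n) (g n)) :=
  (hf.pair hg).of_eq fun n => by simp [Seq.seq]

theorem RecursiveIn.prec_total {O f g : ℕ → ℕ} (hf : RecursiveIn O f) (hg : RecursiveIn O g) :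
    RecursiveIn O fun n => Part.some
      (Nat.rec (motive := fun _ => ℕ) (f n.unpair.1)
        (fun y i => g (Nat.pair n.unpair.1 (Nat.pair y i))) n.unpair.2) :=
  (hf.prec hg).of_eq fun n => by
    simp only [Nat.unpaired]
    induction n.unpair.2 with
    | zero => rfl
    | succ k ih => exact (congrArg (fun p => Part.bind p _) ih).trans (Part.bind_some _ _)

/-- The initial segments of an `O`-recursive family of functions are `O`-recursive. -/
theorem RecursiveIn.initialSegment {O : ℕ → ℕ} {f : ℕ → ℕ} (hf : RecursiveIn O f) :
    RecursiveIn O fun n => Part.some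
      (Encodable.encode ((List.range n.unpair.2).map fun k => f (Nat.pair n.unpair.1 k))) := by
  have hstep : Computable fun m : ℕ =>
      Encodable.encode (Denumerable.ofNat (List ℕ) m.unpair.1 ++ [m.unpair.2]) :=
    (Primrec.encode.comp (Primrec.list_concat.comp
      ((Primrec.ofNat _).comp (Primrec.fst.comp Primrec.unpair))
      (Primrec.snd.comp Primrec.unpair))).to_comp
  have hp : Computable fun m : ℕ => Nat.pair m.unpair.1 m.unpair.2.unpair.1 :=
    (Primrec₂.natPair.comp (Primrec.fst.comp Primrec.unpair)
      (Primrec.fst.comp (Primrec.unpair.comp (Primrec.snd.comp Primrec.unpair)))).to_comp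
  have hi : Computable fun m : ℕ => m.unpair.2.unpair.2 :=
    (Primrec.snd.comp (Primrec.unpair.comp (Primrec.snd.comp Primrec.unpair))).to_comp
  have hg := comp_total (of_computable hstep)
    ((of_computable hi).pair_total (hf.comp_total (of_computable hp)))
  refine (prec_total (of_computable (Computable.const (Encodable.encode ([] : List ℕ))))
    hg).of_eq fun n => ?_
  congr 1
  induction n.unpair.2 with
  | zero => rfl
  | succ k ih =>
    simp only [Nat.unpair_pair] at ih ⊢
    rw [ih, Denumerable.ofNat_encode, List.range_succ, List.map_append, List.map_singleton]

/-- The family of trees of those strings all of whose initial segments satisfy `R n`. -/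
def prefixTree (R : ℕ → List ℕ → Bool) (n : ℕ) : Set (List ℕ) :=
  {l | ∀ k ≤ l.length, R n (l.take k) = true}

theorem prefixClosed_prefixTree (R : ℕ → List ℕ → Bool) (n : ℕ) :
    PrefixClosed (prefixTree R n) := by
  intro l hl l' hl' k hk
  have := hl k (hk.trans hl'.length_le)
  obtain ⟨t, rfl⟩ := hl'
  rwa [List.take_append_of_le_length hk] at this

theorem isPath_prefixTree {R : ℕ → List ℕ → Bool} {n : ℕ} {f : ℕ → ℕ} :
    IsPath (prefixTree R n) f ↔ ∀ k, R n ((List.range k).map f) = true := by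
  constructor
  · intro h k
    have := h k k (by simp)
    rwa [List.take_of_length_le (by simp)] at this
  · intro h k j hj
    rw [← List.map_take, List.take_range]
    exact h _

/-- The Boolean test for membership in `prefixTree R n`. -/
def prefixTest (R : ℕ → List ℕ → Bool) (n : ℕ) (l : List ℕ) : Bool :=
  Nat.rec (motive := fun _ => Bool) true (fun k b => b && R n (l.take k)) (l.length + 1)

theorem prefixTest_eq_true {R : ℕ → List ℕ → Bool} {n : ℕ} {l : List ℕ} :
    prefixTest R n l = true ↔ l ∈ prefixTree R n := by
  have : ∀ m, Nat.rec (motive := fun _ => Bool) true (fun k b => b && R n (l.take k)) m = true ↔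
      ∀ k < m, R n (l.take k) = true := by
    intro m
    induction m with
    | zero => simp
    | succ m ih => simp only [Bool.and_eq_true, ih, Nat.forall_lt_succ_right]
  exact (this _).trans (forall_congr' fun k => imp_congr_left Nat.lt_succ_iff)

theorem computable_prefixTest {R : ℕ → List ℕ → Bool} (hR : Computable₂ R) :
    Computable₂ (prefixTest R) := by
  refine Computable.nat_rec
    (h := fun (p : ℕ × List ℕ) (q : ℕ × Bool) => q.2 && R p.1 (p.2.take q.1))
    (Computable.succ.comp (Computable.list_length.comp Computable.snd))
    (Computable.const true) ?_
  refine Primrec.and.to_comp.comp (Computable.snd.comp Computable.snd) ?_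
  exact hR.comp (Computable.fst.comp Computable.fst)
    (Primrec.list_take.to_comp.comp (Computable.fst.comp Computable.snd)
      (Computable.snd.comp Computable.fst))

theorem computable_encode_unpair {R : ℕ → List ℕ → Bool} (hR : Computable₂ R) :
    Computable fun m : ℕ =>
      Encodable.encode (R m.unpair.1 (Denumerable.ofNat (List ℕ) m.unpair.2)) :=
  Computable.encode.comp (hR.comp (Computable.fst.comp Computable.unpair)
    ((Computable.ofNat _).comp (Computable.snd.comp Computable.unpair)))

theorem treeAt_eq_of_forall_codeFn {e : ℕ} {T : Set (List ℕ)} {χ : List ℕ → Bool}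
    (hT : PrefixClosed T) (hχ : ∀ l, χ l = true ↔ l ∈ T)
    (he : ∀ m, codeFn e m = Part.some (Encodable.encode (χ (Denumerable.ofNat (List ℕ) m)))) :
    treeAt e = T := by
  have hset : {l : List ℕ | codeFn e (Encodable.encode l) = Part.some 1} = T := by
    ext l
    change codeFn e (Encodable.encode l) = Part.some 1 ↔ l ∈ T
    rw [he, Denumerable.ofNat_encode, Part.some_inj, ← hχ]
    cases χ l <;> simp
  rw [treeAt, if_pos ⟨fun m => by simp [he], hset.symm ▸ hT⟩, hset]

theorem exists_computable_index {R : ℕ → List ℕ → Bool} (hR : Computable₂ R) :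
    ∃ s : ℕ → ℕ, Computable s ∧ ∀ n, treeAt (s n) = prefixTree R n := by
  obtain ⟨c, hc⟩ := Nat.Partrec.Code.exists_code.1
    (Partrec.nat_iff.1 (computable_encode_unpair (computable_prefixTest hR)))
  refine ⟨fun n => Encodable.encode (Code.curry c n),
    (Primrec.encode.comp (Nat.Partrec.Code.primrec₂_curry.comp (Primrec.const c)
      Primrec.id)).to_comp, fun n => treeAt_eq_of_forall_codeFn (prefixClosed_prefixTree R n)
        (fun l => prefixTest_eq_true) fun m => ?_⟩
  rw [codeFn, Denumerable.ofNat_encode, Nat.Partrec.Code.eval_curry, hc]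
  simp only [PFun.coe_val, Nat.unpair_pair]

theorem CEIn.of_exists_eq_zero {X A : Set ℕ} {f : ℕ → ℕ} (hf : RecursiveIn (chi X) f)
    (hA : ∀ n, n ∈ A ↔ ∃ k, f (Nat.pair n k) = 0) : CEIn X A := by
  refine ⟨fun n => Nat.rfind fun k => (fun m => decide (m = 0)) <$> (f : ℕ →. ℕ) (Nat.pair n k),
    hf.rfind.of_eq fun n => ?_, fun n => (hA n).trans ?_⟩
  · simp only [Encodable.decode_nat, Part.coe_some, Part.bind_some]
    exact (Part.map_id' (fun _ => rfl) _).symm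
  · refine Iff.trans ?_ Nat.rfind_dom.symm
    simp

theorem ceIn_of_loqHighForPaths_of_pi11 {X A : Set ℕ} (h : LoqHighForPaths X) (hA : Pi11 A) :
    CEIn X A := by
  obtain ⟨F, hF, hpath⟩ := h
  obtain ⟨R, hR, hRA⟩ := hA
  obtain ⟨s, hs, hsR⟩ := exists_computable_index hR
  have hF' : RecursiveIn (chi X) fun m => Part.some (F m.unpair) :=
    RecursiveIn.of_eq (f := fun m => _) hF fun m => by simp
  have hpre : Computable fun m : ℕ => Nat.pair (s m.unpair.1) m.unpair.2 :=
    Primrec₂.natPair.to_comp.comp (hs.comp (Computable.fst.comp Computable.unpair))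
      (Computable.snd.comp Computable.unpair)
  have hseg := (hF'.comp_total (.of_computable hpre)).initialSegment
  have hsearch := RecursiveIn.comp_total (.of_computable (computable_encode_unpair hR))
    ((RecursiveIn.of_computable (Computable.fst.comp Computable.unpair)).pair_total hseg)
  refine CEIn.of_exists_eq_zero hsearch fun n => ?_
  have hzero : ∀ b : Bool, Encodable.encode b = 0 ↔ b = false := by decide
  simp only [Nat.unpair_pair, Denumerable.ofNat_encode, hzero]
  constructor
  · intro hn
    by_contra! hk
    exact (hRA n).2 ⟨fun j => F (s n, j), fun k => by simpa using hk k⟩ hn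
  · rintro ⟨k, hk⟩
    by_contra hn
    obtain ⟨f, hf⟩ := (hRA n).1 hn
    have := hpath (s n) ⟨f, by rw [hsR]; exact isPath_prefixTree.2 hf⟩
    rw [hsR, isPath_prefixTree] at this
    simp [this k] at hk

theorem illFounded_treeAt {e : ℕ} : IllFounded (treeAt e) ↔
    DecidesTree e ∧
      ∃ p : ℕ → ℕ, ∀ k, codeFn e (Encodable.encode ((List.range k).map p)) = Part.some 1 := by
  by_cases h : DecidesTree e <;> simp [IllFounded, IsPath, treeAt, h]

/-- The computation of code `e` on input `i`, run for the number of steps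
recorded in the first half of the `i`-th entry of `l`. -/
def boundedRun (e : ℕ) (l : List ℕ) (i : ℕ) : Option ℕ :=
  Code.evaln (l.getD i 0).unpair.1 (Denumerable.ofNat Code e) i

/-- The path approximation of length `t` recorded in the second halves of the entries of `l`. -/
def pathCode (l : List ℕ) (t : ℕ) : ℕ :=
  Encodable.encode ((l.take t).map fun x => x.unpair.2)

/-- The code of the initial segment of length `t` of the string coded by `i`. -/
def takeCode (i t : ℕ) : ℕ := Encodable.encode ((Denumerable.ofNat (List ℕ) i).take t)

/-- The requirements with parameters `i`, `t` on a witness that code `e` decides an ill-founded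
tree, as far as they are visible in the finite approximation `l` of the witness. -/
def Requirement (e : ℕ) (l : List ℕ) (i t : ℕ) : Prop :=
  (l.length ≤ i ∨ ¬ boundedRun e l i = none) ∧
  ((l.length ≤ i ∨ l.length ≤ takeCode i t) ∨
    (¬ boundedRun e l i = some 1 ∨ boundedRun e l (takeCode i t) = some 1)) ∧
  ((l.length ≤ t ∨ l.length ≤ pathCode l t) ∨ boundedRun e l (pathCode l t) = some 1)

theorem primrecPred_requirement :
    PrimrecPred fun p : (ℕ × List ℕ) × ℕ × ℕ => Requirement p.1.1 p.1.2 p.2.1 p.2.2 := by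
  have he : Primrec fun p : (ℕ × List ℕ) × ℕ × ℕ => p.1.1 := Primrec.fst.comp Primrec.fst
  have hl : Primrec fun p : (ℕ × List ℕ) × ℕ × ℕ => p.1.2 := Primrec.snd.comp Primrec.fst
  have hi : Primrec fun p : (ℕ × List ℕ) × ℕ × ℕ => p.2.1 := Primrec.fst.comp Primrec.snd
  have ht : Primrec fun p : (ℕ × List ℕ) × ℕ × ℕ => p.2.2 := Primrec.snd.comp Primrec.snd
  have hlen := Primrec.list_length.comp hl
  have hrun : ∀ {j : (ℕ × List ℕ) × ℕ × ℕ → ℕ}, Primrec j →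
      Primrec fun p : (ℕ × List ℕ) × ℕ × ℕ => boundedRun p.1.1 p.1.2 (j p) := fun hj =>
    Nat.Partrec.Code.primrec_evaln.comp (((Primrec.fst.comp (Primrec.unpair.comp
      ((Primrec.list_getD 0).comp hl hj))).pair ((Primrec.ofNat Code).comp he)).pair hj)
  have htake : Primrec fun p : (ℕ × List ℕ) × ℕ × ℕ => takeCode p.2.1 p.2.2 :=
    Primrec.encode.comp (Primrec.list_take.comp ht ((Primrec.ofNat _).comp hi))
  have hpath : Primrec fun p : (ℕ × List ℕ) × ℕ × ℕ => pathCode p.1.2 p.2.2 :=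
    Primrec.encode.comp (Primrec.list_map (Primrec.list_take.comp ht hl)
      (Primrec.snd.comp (Primrec.unpair.comp Primrec.snd)))
  have hle : ∀ {j : (ℕ × List ℕ) × ℕ × ℕ → ℕ}, Primrec j →
      PrimrecPred fun p : (ℕ × List ℕ) × ℕ × ℕ => p.1.2.length ≤ j p := fun hj =>
    Primrec.nat_le.comp hlen hj
  have hone : ∀ {j : (ℕ × List ℕ) × ℕ × ℕ → ℕ}, Primrec j →
      PrimrecPred fun p : (ℕ × List ℕ) × ℕ × ℕ => boundedRun p.1.1 p.1.2 (j p) = some 1 :=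
    fun hj => Primrec.eq.comp (hrun hj) (Primrec.const _)
  exact ((hle hi).or (Primrec.eq.comp (hrun hi) (Primrec.const _)).not).and
    ((((hle hi).or (hle htake)).or ((hone hi).not.or (hone htake))).and
      (((hle ht).or (hle hpath)).or (hone hpath)))

theorem forall_requirement_iff {e : ℕ} {f : ℕ → ℕ} :
    (∀ k : ℕ, Requirement e ((List.range k).map f) k.unpair.1.unpair.1 k.unpair.1.unpair.2) ↔
      (∀ i, Code.evaln (f i).unpair.1 (Denumerable.ofNat Code e) i ≠ none) ∧
      (∀ i t, Code.evaln (f i).unpair.1 (Denumerable.ofNat Code e) i = some 1 →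
        Code.evaln (f (takeCode i t)).unpair.1 (Denumerable.ofNat Code e) (takeCode i t)
          = some 1) ∧
      ∀ t r, r = Encodable.encode ((List.range t).map fun j => (f j).unpair.2) →
        Code.evaln (f r).unpair.1 (Denumerable.ofNat Code e) r = some 1 := by
  have hrun : ∀ {k i : ℕ}, i < k → boundedRun e ((List.range k).map f) i =
      Code.evaln (f i).unpair.1 (Denumerable.ofNat Code e) i := by
    intro k i hik
    simp [boundedRun, hik]
  have hpath : ∀ {k t : ℕ}, t ≤ k → pathCode ((List.range k).map f) t =
      Encodable.encode ((List.range t).map fun j => (f j).unpair.2) := by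
    intro k t htk
    simp [pathCode, ← List.map_take, List.take_range, htk, Function.comp_def]
  constructor
  · intro h
    have key : ∀ i t N, ∃ k, N ≤ k ∧ Requirement e ((List.range k).map f) i t := by
      intro i t N
      refine ⟨Nat.pair (Nat.pair i t) N, Nat.right_le_pair _ _, ?_⟩
      simpa using h (Nat.pair (Nat.pair i t) N)
    refine ⟨fun i => ?_, fun i t h1 => ?_, fun t r hr => ?_⟩
    · obtain ⟨k, hk, hq, -⟩ := key i 0 (i + 1)
      rw [hrun (by omega)] at hq
      simpa [show ¬ k ≤ i by omega] using hq
    · obtain ⟨k, hk, -, hq, -⟩ := key i t (i + takeCode i t + 1)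
      rw [hrun (by omega), hrun (by omega)] at hq
      simpa [show ¬ k ≤ i by omega, show ¬ k ≤ takeCode i t by omega, h1] using hq
    · obtain ⟨k, hk, -, -, hq⟩ := key 0 t (t + r + 1)
      rw [hpath (by omega), ← hr, hrun (by omega)] at hq
      simpa [show ¬ k ≤ t by omega, show ¬ k ≤ r by omega] using hq
  · rintro ⟨h1, h2, h3⟩ k
    generalize k.unpair.1.unpair.1 = i
    generalize k.unpair.1.unpair.2 = t
    simp only [Requirement, List.length_map, List.length_range]
    refine ⟨?_, ?_, ?_⟩
    · rcases le_or_gt k i with hi | hi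
      · exact .inl hi
      · exact .inr (hrun hi ▸ h1 i)
    · rcases le_or_gt k i with hi | hi
      · exact .inl (.inl hi)
      rcases le_or_gt k (takeCode i t) with hj | hj
      · exact .inl (.inr hj)
      rw [hrun hi, hrun hj]
      exact .inr (imp_iff_not_or.1 (h2 i t))
    · rcases le_or_gt k t with ht | ht
      · exact .inl (.inl ht)
      rcases le_or_gt k (pathCode ((List.range k).map f) t) with hj | hj
      · exact .inl (.inr hj)
      rw [hrun hj]
      exact .inr (h3 t _ (hpath ht.le))

theorem illFounded_treeAt_iff_exists {e : ℕ} : IllFounded (treeAt e) ↔ ∃ f : ℕ → ℕ, ∀ k : ℕ,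
    Requirement e ((List.range k).map f) k.unpair.1.unpair.1 k.unpair.1.unpair.2 := by
  simp only [forall_requirement_iff, illFounded_treeAt]
  constructor
  · rintro ⟨⟨htot, hpre⟩, p, hp⟩
    have hw : ∀ i, ∃ w, (codeFn e i).get (htot i) ∈
        Code.evaln w (Denumerable.ofNat Code e) i := fun i =>
      Nat.Partrec.Code.evaln_complete.1 (Part.get_mem (htot i))
    choose w hw using hw
    have hone : ∀ i, codeFn e i = Part.some 1 ↔
        Code.evaln (w i) (Denumerable.ofNat Code e) i = some 1 := by
      intro i
      rw [Option.mem_def.1 (hw i), Option.some_inj, Part.eq_some_iff]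
      exact ⟨fun h => Part.get_eq_of_mem h _, fun h => h ▸ Part.get_mem _⟩
    refine ⟨fun i => Nat.pair (w i) (p i), ?_⟩
    simp only [Nat.unpair_pair, ← hone]
    refine ⟨fun i => by simp [Option.mem_def.1 (hw i)], fun i t hi => ?_, ?_⟩
    · exact hpre (Denumerable.ofNat (List ℕ) i) (by simpa using hi) _ (List.take_prefix _ _)
    · rintro t r rfl
      exact hp t
  · rintro ⟨f, h1, h2, h3⟩
    have hsound : ∀ {i v}, Code.evaln (f i).unpair.1 (Denumerable.ofNat Code e) i = some v →
        codeFn e i = Part.some v := fun h =>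
      Part.eq_some_iff.2 (Nat.Partrec.Code.evaln_sound h)
    refine ⟨⟨fun i => ?_, fun l hl l' hl' => ?_⟩, fun j => (f j).unpair.2,
      fun k => hsound (h3 k _ rfl)⟩
    · obtain ⟨v, hv⟩ := Option.ne_none_iff_exists'.1 (h1 i)
      simp [hsound hv]
    · obtain ⟨v, hv⟩ := Option.ne_none_iff_exists'.1 (h1 (Encodable.encode l))
      have hv1 : v = 1 := Part.some_inj.1 ((hsound hv).symm.trans hl)
      have := hsound (h2 _ l'.length (hv1 ▸ hv))
      rwa [takeCode, Denumerable.ofNat_encode, ← List.prefix_iff_eq_take.1 hl'] at this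

theorem pi11_WF : Pi11 WF := by
  classical
  refine ⟨fun e l => decide (Requirement e l l.length.unpair.1.unpair.1
    l.length.unpair.1.unpair.2), ?_, fun e => ?_⟩
  · have hq : Primrec fun p : ℕ × List ℕ => p.2.length.unpair.1.unpair :=
      Primrec.unpair.comp (Primrec.fst.comp (Primrec.unpair.comp
        (Primrec.list_length.comp Primrec.snd)))
    exact (primrecPred_requirement.comp (Primrec.id.pair hq)).decide.to_comp
  · simp [WF, illFounded_treeAt_iff_exists]

/-- If `X` is loquaciously high for paths, then every Π¹₁ subset of ℕ
is c.e. in `X`; in particular, `WF` is c.e. in `X`. -/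
theorem loqHighForPaths_enumerates_Pi11 (X : Set ℕ) (h : LoqHighForPaths X) :
    (∀ A : Set ℕ, Pi11 A → CEIn X A) ∧ CEIn X WF := by
  exact ⟨fun _ => ceIn_of_loqHighForPaths_of_pi11 h,
    ceIn_of_loqHighForPaths_of_pi11 h pi11_WF⟩

end CFT
end

section
/- Fix the effective listing (U_n)_{n∈ℕ} of Σ¹₁ subsets of ℕ given by U_n = {m : ∃ f : ℕ → ℕ, ∀ k, the n-th partial computable function converges to 1 on the code of the pair (m, [f(0),…,f(k−1)])}. Then a set X ⊆ ℕ is loquaciously high for descending sequences if and only if there is a total X-computable function h : ℕ → ℕ such that for every n with U_n ≠ ∅, h(n) ≥ min U_n. -/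
namespace CFT

open Nat.Partrec (Code)

/-- The effective listing of Σ¹₁ subsets of ℕ: `m ∈ sigmaU n` iff there is an
`f : ℕ → ℕ` such that the `n`-th partial computable function converges to `1` on
the code of the pair `(m, [f 0, …, f (k-1)])` for every `k`. -/
def sigmaU (n : ℕ) : Set ℕ :=
  {m | ∃ f : ℕ → ℕ, ∀ k,
    codeFn n (Nat.pair m (Encodable.encode ((List.range k).map f))) = Part.some 1}

/-! ### Codes and uniform families -/

/-- The universal function, taking the code of an index-argument pair. -/
def univ (z : ℕ) : Part ℕ := codeFn z.unpair.1 z.unpair.2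

theorem partrec_univ : Partrec univ :=
  Nat.Partrec.Code.eval_part.comp
    ((Computable.ofNat Code).comp (Computable.fst.comp Computable.unpair))
    (Computable.snd.comp Computable.unpair)

/-- The parametrization theorem for `codeFn`. -/
theorem exists_primrec_index {F : ℕ →. ℕ} (hF : Partrec F) :
    ∃ q : ℕ → ℕ, Primrec q ∧ ∀ p x, codeFn (q p) x = F (Nat.pair p x) := by
  obtain ⟨c, hc⟩ := Nat.Partrec.Code.exists_code.1 (Partrec.nat_iff.1 hF)
  refine ⟨fun p => Encodable.encode (c.curry p),
    Primrec.encode.comp (Nat.Partrec.Code.primrec₂_curry.comp (Primrec.const c) Primrec.id), ?_⟩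
  intro p x
  simp [codeFn, Nat.Partrec.Code.eval_curry, hc]

/-- Uniformly primitive recursive predicates have primitive recursive indices. -/
theorem exists_primrec_index_of_primrecRel {R : ℕ → ℕ → Prop} (hR : PrimrecRel R) :
    ∃ q : ℕ → ℕ, Primrec q ∧ (∀ p x, (codeFn (q p) x).Dom) ∧
      ∀ p x, codeFn (q p) x = Part.some 1 ↔ R p x := by
  classical
  have hF : Primrec fun z : ℕ => if R z.unpair.1 z.unpair.2 then 1 else 0 :=
    Primrec.ite (hR.comp (Primrec.fst.comp Primrec.unpair) (Primrec.snd.comp Primrec.unpair))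
      (Primrec.const 1) (Primrec.const 0)
  obtain ⟨q, hq, hqF⟩ := exists_primrec_index hF.to_comp.partrec
  refine ⟨q, hq, fun p x => ?_, fun p x => ?_⟩
  · rw [hqF]; trivial
  · rw [hqF]
    simp only [PFun.coe_val, Nat.unpair_pair, Part.some_inj]
    split_ifs <;> simp_all

/-! ### Total functions recursive in an oracle -/

/-- The total function `f` is recursive in `O`. -/
def TotalRec (O f : ℕ → ℕ) : Prop := RecursiveIn O (f : ℕ →. ℕ)

theorem totalRec_iff_computableIn {O f : ℕ → ℕ} : TotalRec O f ↔ ComputableIn O f := by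
  have : (f : ℕ →. ℕ) = fun n => Part.bind (Part.ofOption (Encodable.decode (α := ℕ) n))
      fun a => ((f : ℕ →. ℕ) a).map Encodable.encode := by
    funext n
    simp
  rw [ComputableIn, PartrecIn, TotalRec, ← this]

theorem totalRec_iff_computableIn_uncurried {O : ℕ → ℕ} {g : ℕ × ℕ → ℕ} :
    TotalRec O (fun z => g z.unpair) ↔ ComputableIn O g := by
  have : ((fun z => g z.unpair : ℕ → ℕ) : ℕ →. ℕ) =
      fun n => Part.bind (Part.ofOption (Encodable.decode (α := ℕ × ℕ) n))
        fun a => ((g : ℕ × ℕ →. ℕ) a).map Encodable.encode := by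
    funext n
    simp
  rw [ComputableIn, PartrecIn, TotalRec, ← this]

namespace TotalRec

variable {O f g : ℕ → ℕ}

theorem of_primrec (hf : Primrec f) : TotalRec O f :=
  .of_partrec (Partrec.nat_iff.1 hf.to_comp.partrec)

theorem comp (hf : TotalRec O f) (hg : TotalRec O g) : TotalRec O fun n => f (g n) := by
  have := RecursiveIn.comp hf hg
  have e : ((fun n => f (g n) : ℕ → ℕ) : ℕ →. ℕ) =
      fun n => (g : ℕ →. ℕ) n >>= (f : ℕ →. ℕ) := by
    funext n; exact (Part.bind_some _ _).symm
  rwa [TotalRec, e]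

theorem pair (hf : TotalRec O f) (hg : TotalRec O g) :
    TotalRec O fun n => Nat.pair (f n) (g n) := by
  have := RecursiveIn.pair hf hg
  have e : ((fun n => Nat.pair (f n) (g n) : ℕ → ℕ) : ℕ →. ℕ) =
      fun n => Nat.pair <$> (f : ℕ →. ℕ) n <*> (g : ℕ →. ℕ) n := by
    funext n; simp [Seq.seq]
  rwa [TotalRec, e]

theorem primrec₂_comp {C : ℕ → ℕ → ℕ} (hC : Primrec₂ C) (hf : TotalRec O f) (hg : TotalRec O g) :
    TotalRec O fun n => C (f n) (g n) := by
  have h : Primrec fun z : ℕ => C z.unpair.1 z.unpair.2 :=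
    hC.comp (Primrec.fst.comp Primrec.unpair) (Primrec.snd.comp Primrec.unpair)
  simpa using (of_primrec h).comp (hf.pair hg)

theorem natRec (hf : TotalRec O f) (hg : TotalRec O g) : TotalRec O fun z =>
    Nat.rec (f z.unpair.1) (fun y i => g (Nat.pair z.unpair.1 (Nat.pair y i))) z.unpair.2 := by
  have h := RecursiveIn.prec hf hg
  refine (congrArg (RecursiveIn O) (funext fun z => ?_)).mp h
  simp only [Nat.unpaired, PFun.coe_val]
  induction z.unpair.2 with
  | zero => rfl
  | succ n ih => simp only [ih]; simp

end TotalRec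

/-! ### From bounds to descending sequences -/

/-- `h n` bounds the minimum of the `n`-th `Σ¹₁` set, if that set is nonempty. -/
def BoundsMinima (h : ℕ → ℕ) : Prop := ∀ n, (sigmaU n).Nonempty → sInf (sigmaU n) ≤ h n

/-- A function bounding minima of `Σ¹₁` sets computes a total extension of the universal partial
computable function. -/
theorem exists_total_extension {O h : ℕ → ℕ} (hh : TotalRec O h) (hb : BoundsMinima h) :
    ∃ P : ℕ → ℕ, TotalRec O P ∧ ∀ z v, univ z = Part.some v → P z = v := by
  have hev : Primrec fun w : ℕ × ℕ =>
      Code.evaln w.2 (Denumerable.ofNat Code w.1.unpair.1) w.1.unpair.2 :=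
    Nat.Partrec.Code.primrec_evaln.comp ((Primrec.snd.pair ((Primrec.ofNat Code).comp
      (Primrec.fst.comp (Primrec.unpair.comp Primrec.fst)))).pair
      (Primrec.snd.comp (Primrec.unpair.comp Primrec.fst)))
  have hR : PrimrecRel fun z x : ℕ =>
      (Code.evaln x.unpair.1 (Denumerable.ofNat Code z.unpair.1) z.unpair.2).isSome = true :=
    Primrec.eq.comp (Primrec.option_isSome.comp (hev.comp (Primrec.fst.pair
      (Primrec.fst.comp (Primrec.unpair.comp Primrec.snd))))) (Primrec.const true)
  obtain ⟨q, hq, -, hqR⟩ := exists_primrec_index_of_primrecRel hR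
  refine ⟨fun z =>
    (Code.evaln (h (q z)) (Denumerable.ofNat Code z.unpair.1) z.unpair.2).getD 0, ?_, ?_⟩
  · exact TotalRec.primrec₂_comp (C := fun z t =>
      (Code.evaln t (Denumerable.ofNat Code z.unpair.1) z.unpair.2).getD 0)
      (Primrec.option_getD.comp hev (Primrec.const 0))
      (.of_primrec Primrec.id) (hh.comp (.of_primrec hq))
  · intro z v hv
    have hU : ∀ t, t ∈ sigmaU (q z) ↔
        (Code.evaln t (Denumerable.ofNat Code z.unpair.1) z.unpair.2).isSome = true := by
      intro t
      simp [sigmaU, hqR]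
    have hv' : v ∈ Code.eval (Denumerable.ofNat Code z.unpair.1) z.unpair.2 :=
      Part.eq_some_iff.1 hv
    obtain ⟨t, ht⟩ := Nat.Partrec.Code.evaln_complete.1 hv'
    have hne : (sigmaU (q z)).Nonempty := ⟨t, (hU t).2 (by rw [Option.mem_def.1 ht]; rfl)⟩
    obtain ⟨w, hw⟩ := Option.isSome_iff_exists.1 ((hU _).1 (Nat.sInf_mem hne))
    have hw' := Nat.Partrec.Code.evaln_mono (hb _ hne) hw
    simp only [Option.mem_def.1 hw', Option.getD_some]
    exact Part.mem_unique (Nat.Partrec.Code.evaln_sound hw') hv'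

/-- The input of `univ` deciding whether `x` lies below `y - 1` in the `n`-th linear order with a
top element added; `y = 0` stands for the top element. -/
def belowQuery (n x y : ℕ) : ℕ :=
  if y = 0 then Nat.pair n.unpair.1 x else Nat.pair n.unpair.2 (Nat.pair x (y - 1))

theorem primrec_belowQuery {α : Type*} [Primcodable α] {f g k : α → ℕ} (hf : Primrec f)
    (hg : Primrec g) (hk : Primrec k) : Primrec fun a => belowQuery (f a) (g a) (k a) :=
  Primrec.ite (Primrec.eq.comp hk (Primrec.const 0))
    (Primrec₂.natPair.comp (Primrec.fst.comp (Primrec.unpair.comp hf)) hg)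
    (Primrec₂.natPair.comp (Primrec.snd.comp (Primrec.unpair.comp hf))
      (Primrec₂.natPair.comp hg (Primrec.nat_sub.comp hk (Primrec.const 1))))

/-- `x` lies below `y - 1`, where `y = 0` stands for an added top element. -/
def LinOrd.Below (L : LinOrd) (x y : ℕ) : Prop := if y = 0 then x ∈ L.dom else L.lt x (y - 1)

theorem LinOrd.below_zero {L : LinOrd} {x : ℕ} : L.Below x 0 ↔ x ∈ L.dom := by simp [Below]

theorem LinOrd.below_succ {L : LinOrd} {x y : ℕ} : L.Below x (y + 1) ↔ L.lt x y := by simp [Below]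

theorem LinOrd.Below.mem_dom {L : LinOrd} (hL : L.IsValid) {x y : ℕ} (h : L.Below x y) :
    x ∈ L.dom := by
  rcases y with _ | y
  · exact below_zero.1 h
  · exact (hL.1 _ _ (below_succ.1 h)).1

theorem DecidesLinOrd.linOrdAt_eq {n : ℕ} (hn : DecidesLinOrd n) :
    linOrdAt n = linOrdOfCodes n := if_pos hn

theorem DecidesLinOrd.isValid {n : ℕ} (hn : DecidesLinOrd n) : (linOrdAt n).IsValid :=
  hn.linOrdAt_eq ▸ hn.2.2

theorem DecidesLinOrd.univ_belowQuery {n : ℕ} (hn : DecidesLinOrd n) (x y : ℕ) :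
    univ (belowQuery n x y) = Part.some 1 ↔ (linOrdAt n).Below x y := by
  rw [hn.linOrdAt_eq]
  unfold univ belowQuery LinOrd.Below linOrdOfCodes
  split_ifs <;> simp

theorem DecidesLinOrd.univ_belowQuery_dom {n : ℕ} (hn : DecidesLinOrd n) (x y : ℕ) :
    (univ (belowQuery n x y)).Dom := by
  unfold univ belowQuery
  split_ifs
  · simpa using hn.1 x
  · simpa using hn.2.1 _

theorem DecidesLinOrd.extension_eq_one_iff {n : ℕ} (hn : DecidesLinOrd n) {P : ℕ → ℕ}
    (hP : ∀ z v, univ z = Part.some v → P z = v) (x y : ℕ) :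
    P (belowQuery n x y) = 1 ↔ (linOrdAt n).Below x y := by
  rw [← hn.univ_belowQuery]
  refine ⟨fun h => ?_, hP _ _⟩
  have hv := (Part.some_get (hn.univ_belowQuery_dom x y)).symm
  rw [hv, ← hP _ _ hv, h]

theorem decidesLinOrd_of_illFounded {n : ℕ} (h : (linOrdAt n).IllFounded) : DecidesLinOrd n := by
  by_contra hn
  obtain ⟨f, hf⟩ := h
  have := (hf 0).1
  simp [linOrdAt, hn] at this

/-- The elements below `y - 1` that start a descending sequence, where `y = 0` stands for an added
top element. -/
def LinOrd.descStarts (L : LinOrd) (y : ℕ) : Set ℕ :=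
  {m | L.Below m y ∧ ∃ d, IsDescSeq L d ∧ d 0 = m}

/-- The sets `descStarts` are uniformly `Σ¹₁`. -/
theorem exists_sigmaU_eq_descStarts : ∃ q : ℕ → ℕ, Primrec q ∧ ∀ n y, DecidesLinOrd n →
    sigmaU (q (Nat.pair n y)) = (linOrdAt n).descStarts y := by
  let T : ℕ → List ℕ := fun z =>
    z.unpair.1.unpair.2 :: (z.unpair.2.unpair.1 + 1) ::
      (Denumerable.ofNat (List ℕ) z.unpair.2.unpair.2).map Nat.succ
  let len : ℕ → ℕ := fun z => (Denumerable.ofNat (List ℕ) z.unpair.2.unpair.2).length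
  have h1 : Primrec fun z : ℕ => z.unpair.1 := Primrec.fst.comp Primrec.unpair
  have h2 : Primrec fun z : ℕ => z.unpair.2 := Primrec.snd.comp Primrec.unpair
  have hl : Primrec fun z : ℕ => Denumerable.ofNat (List ℕ) z.unpair.2.unpair.2 :=
    (Primrec.ofNat _).comp (h2.comp h2)
  have hT : Primrec T := Primrec.list_cons.comp (h2.comp h1) (Primrec.list_cons.comp
    (Primrec.succ.comp (h1.comp h2)) (Primrec.list_map hl (Primrec.succ.comp Primrec.snd).to₂))
  have hlen : Primrec len := Primrec.list_length.comp hl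
  have hq := primrec_belowQuery (h1.comp h1)
    (Primrec.nat_sub.comp ((Primrec.list_getD 0).comp hT (Primrec.succ.comp hlen))
      (Primrec.const 1))
    ((Primrec.list_getD 0).comp hT hlen)
  obtain ⟨q, hq, hqF⟩ := exists_primrec_index (partrec_univ.comp hq.to_comp)
  refine ⟨q, hq, fun n y hn => Set.ext fun m => ?_⟩
  have key : ∀ f : ℕ → ℕ,
      (∀ k, codeFn (q (Nat.pair n y))
        (Nat.pair m (Encodable.encode ((List.range k).map f))) = Part.some 1) ↔
      (linOrdAt n).Below m y ∧ (linOrdAt n).lt (f 0) m ∧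
        ∀ i, (linOrdAt n).lt (f (i + 1)) (f i) := by
    intro f
    simp only [hqF, T, len, Nat.unpair_pair, Denumerable.ofNat_encode, List.length_map,
      List.length_range, hn.univ_belowQuery]
    constructor
    · intro h
      refine ⟨by simpa using h 0, ?_, fun i => ?_⟩
      · simpa [LinOrd.below_succ] using h 1
      · simpa [LinOrd.below_succ, List.getD_eq_getElem?_getD] using h (i + 2)
    · rintro ⟨h0, h1, h⟩ k
      rcases k with _ | _ | i
      · simpa using h0
      · simpa [LinOrd.below_succ] using h1
      · simpa [LinOrd.below_succ, List.getD_eq_getElem?_getD] using h i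
  simp only [sigmaU, LinOrd.descStarts, Set.mem_ofPred_eq, key]
  constructor
  · rintro ⟨f, hm, h0, h⟩
    refine ⟨hm, fun i => Nat.casesOn i m f, fun i => ?_, rfl⟩
    rcases i with _ | i
    · exact ⟨hm.mem_dom hn.isValid, h0⟩
    · exact ⟨(hn.isValid.1 _ _ (h i)).2, h i⟩
  · rintro ⟨hm, d, hd, rfl⟩
    exact ⟨fun i => d (i + 1), hm, (hd 0).2, fun i => (hd (i + 1)).2⟩

/-- One step of the search for a maximum: `r` is the current maximum plus one, or `0` if no element
has been found, and `c` is the candidate. -/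
def maxStep (P : ℕ → ℕ) (n y c r : ℕ) : ℕ :=
  if P (belowQuery n c y) = 1 ∧ (r = 0 ∨ P (belowQuery n (r - 1) (c + 1)) = 1) then c + 1 else r

/-- The maximum plus one of the elements less than `k` which lie below `y - 1`. -/
def maxBelow (P : ℕ → ℕ) (n y k : ℕ) : ℕ := Nat.rec 0 (fun c r => maxStep P n y c r) k

theorem maxBelow_spec {P : ℕ → ℕ} {n : ℕ} (hn : DecidesLinOrd n)
    (hP : ∀ z v, univ z = Part.some v → P z = v) (y k : ℕ) :
    (maxBelow P n y k ≠ 0 → (linOrdAt n).Below (maxBelow P n y k - 1) y) ∧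
    ∀ c < k, (linOrdAt n).Below c y → maxBelow P n y k ≠ 0 ∧
      (c = maxBelow P n y k - 1 ∨ (linOrdAt n).lt c (maxBelow P n y k - 1)) := by
  induction k with
  | zero => simp [maxBelow]
  | succ k ih =>
    obtain ⟨ih1, ih2⟩ := ih
    have hstep : maxBelow P n y (k + 1) = maxStep P n y k (maxBelow P n y k) := rfl
    rw [hstep]
    generalize maxBelow P n y k = r at ih1 ih2 ⊢
    have hL := hn.isValid
    unfold maxStep
    split_ifs with h <;>
      rw [hn.extension_eq_one_iff hP, hn.extension_eq_one_iff hP, LinOrd.below_succ] at h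
    · refine ⟨fun _ => h.1, fun c hc hcy => ⟨by simp, ?_⟩⟩
      rcases Nat.lt_succ_iff_lt_or_eq.1 hc with hc | rfl
      · obtain ⟨hr, hcr⟩ := ih2 c hc hcy
        have hrk := h.2.resolve_left hr
        rcases hcr with rfl | hcr
        · exact .inr hrk
        · exact .inr (hL.2.2.1 _ _ _ hcr hrk)
      · exact .inl rfl
    · refine ⟨ih1, fun c hc hcy => ?_⟩
      rcases Nat.lt_succ_iff_lt_or_eq.1 hc with hc | rfl
      · exact ih2 c hc hcy
      · have h' : ¬(r = 0 ∨ (linOrdAt n).lt (r - 1) c) := fun h' => h ⟨hcy, h'⟩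
        push Not at h'
        refine ⟨h'.1, ?_⟩
        rcases hL.2.2.2 c (hcy.mem_dom hL) (r - 1) ((ih1 h'.1).mem_dom hL) with e | e | e
        · exact .inl e
        · exact .inr e
        · exact absurd e h'.2

theorem totalRec_maxBelow {O P : ℕ → ℕ} (hP : TotalRec O P) :
    TotalRec O fun z => maxBelow P z.unpair.1.unpair.1 z.unpair.1.unpair.2 z.unpair.2 := by
  have h1 : Primrec fun z : ℕ => z.unpair.1 := Primrec.fst.comp Primrec.unpair
  have h2 : Primrec fun z : ℕ => z.unpair.2 := Primrec.snd.comp Primrec.unpair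
  have hq1 : Primrec fun z : ℕ =>
      belowQuery z.unpair.1.unpair.1 z.unpair.2.unpair.1 z.unpair.1.unpair.2 :=
    primrec_belowQuery (h1.comp h1) (h1.comp h2) (h2.comp h1)
  have hq2 : Primrec fun z : ℕ =>
      belowQuery z.unpair.1.unpair.1 (z.unpair.2.unpair.2 - 1) (z.unpair.2.unpair.1 + 1) :=
    primrec_belowQuery (h1.comp h1) (Primrec.nat_sub.comp (h2.comp h2) (Primrec.const 1))
      (Primrec.succ.comp (h1.comp h2))
  have hC : Primrec₂ fun z v : ℕ =>
      if v.unpair.1 = 1 ∧ (z.unpair.2.unpair.2 = 0 ∨ v.unpair.2 = 1)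
        then z.unpair.2.unpair.1 + 1 else z.unpair.2.unpair.2 :=
    Primrec.ite
      ((Primrec.eq.comp (h1.comp Primrec.snd) (Primrec.const 1)).and
        ((Primrec.eq.comp (h2.comp (h2.comp Primrec.fst)) (Primrec.const 0)).or
          (Primrec.eq.comp (h2.comp Primrec.snd) (Primrec.const 1))))
      (Primrec.succ.comp (h1.comp (h2.comp Primrec.fst))) (h2.comp (h2.comp Primrec.fst))
  have hstep := TotalRec.primrec₂_comp hC (.of_primrec Primrec.id)
    ((hP.comp (.of_primrec hq1)).pair (hP.comp (.of_primrec hq2)))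
  simpa [maxBelow, maxStep] using
    TotalRec.natRec (.of_primrec (Primrec.const 0)) hstep

theorem loqHighForDS_of_boundsMinima {X : Set ℕ} {h : ℕ → ℕ} (hh : ComputableIn (chi X) h)
    (hb : BoundsMinima h) : LoqHighForDS X := by
  rw [← totalRec_iff_computableIn] at hh
  obtain ⟨P, hPrec, hP⟩ := exists_total_extension hh hb
  obtain ⟨q, hq, hqS⟩ := exists_sigmaU_eq_descStarts
  let next : ℕ → ℕ := fun z => maxBelow P z.unpair.1 z.unpair.2 (h (q z) + 1)
  have hnext : TotalRec (chi X) next := by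
    have := (totalRec_maxBelow hPrec).comp ((TotalRec.of_primrec Primrec.id).pair
      ((TotalRec.of_primrec Primrec.succ).comp (hh.comp (.of_primrec hq))))
    simpa using this
  let seq : ℕ → ℕ → ℕ := fun n k => Nat.rec 0 (fun _ y => next (Nat.pair n y)) k
  have hseq : TotalRec (chi X) fun z => seq z.unpair.1 z.unpair.2 := by
    have hpair : Primrec fun z : ℕ => Nat.pair z.unpair.1 z.unpair.2.unpair.2 :=
      Primrec₂.natPair.comp (Primrec.fst.comp Primrec.unpair)
        (Primrec.snd.comp (Primrec.unpair.comp (Primrec.snd.comp Primrec.unpair)))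
    simpa [seq] using TotalRec.natRec (.of_primrec (Primrec.const 0))
      (hnext.comp (.of_primrec hpair))
  refine ⟨fun z => seq z.1 (z.2 + 1) - 1, totalRec_iff_computableIn_uncurried.1 ?_, ?_⟩
  · have hpair : Primrec fun z : ℕ => Nat.pair z.unpair.1 (z.unpair.2 + 1) :=
      Primrec₂.natPair.comp (Primrec.fst.comp Primrec.unpair)
        (Primrec.succ.comp (Primrec.snd.comp Primrec.unpair))
    simpa using (TotalRec.of_primrec Primrec.pred).comp (hseq.comp (.of_primrec hpair))
  · intro n hill
    have hn := decidesLinOrd_of_illFounded hill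
    have hL := hn.isValid
    have step : ∀ y, ((linOrdAt n).descStarts y).Nonempty →
        next (Nat.pair n y) ≠ 0 ∧ (linOrdAt n).Below (next (Nat.pair n y) - 1) y ∧
        ((linOrdAt n).descStarts (next (Nat.pair n y))).Nonempty := by
      intro y hy
      rw [← hqS n y hn] at hy
      have hle := hb _ hy
      have hmem := Nat.sInf_mem hy
      generalize sInf (sigmaU (q (Nat.pair n y))) = m at hle hmem
      rw [hqS n y hn] at hmem
      obtain ⟨hmy, d, hd, rfl⟩ := hmem
      have hspec := maxBelow_spec hn hP y (h (q (Nat.pair n y)) + 1)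
      have hnx : maxBelow P n y (h (q (Nat.pair n y)) + 1) = next (Nat.pair n y) := by
        simp [next]
      rw [hnx] at hspec
      obtain ⟨hne, hc⟩ := hspec.2 (d 0) (Nat.lt_succ_of_le hle) hmy
      refine ⟨hne, hspec.1 hne, ?_⟩
      obtain ⟨b, hbn⟩ := Nat.exists_eq_succ_of_ne_zero hne
      rw [hbn] at hc ⊢
      rcases hc with hc | hc
      · refine ⟨d 1, LinOrd.below_succ.2 ?_, fun i => d (i + 1), fun i => hd (i + 1), rfl⟩
        simp only [Nat.succ_eq_add_one, Nat.add_sub_cancel] at hc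
        exact hc ▸ (hd 0).2
      · exact ⟨d 0, LinOrd.below_succ.2 hc, d, hd, rfl⟩
    have hgood : ∀ k, ((linOrdAt n).descStarts (seq n k)).Nonempty := by
      intro k
      induction k with
      | zero =>
        obtain ⟨d, hd⟩ := hill
        exact ⟨d 0, LinOrd.below_zero.2 (hd 0).1, d, hd, rfl⟩
      | succ k ih => exact (step _ ih).2.2
    intro i
    have hi := step _ (hgood i)
    have hi' := step _ (hgood (i + 1))
    refine ⟨hi.2.1.mem_dom hL, ?_⟩
    obtain ⟨b, hbn⟩ := Nat.exists_eq_succ_of_ne_zero hi.1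
    have hs : seq n (i + 1) = b + 1 := hbn
    have h2 := hi'.2.1
    rw [hs, LinOrd.below_succ] at h2
    simp only [hs, Nat.add_sub_cancel]
    change (linOrdAt n).lt (next (Nat.pair n (seq n (i + 1))) - 1) b
    rwa [hs]

/-! ### The Kleene–Brouwer order -/

/-- The strict Kleene–Brouwer order on finite sequences. -/
def KB : List ℕ → List ℕ → Prop
  | [], _ => False
  | _ :: _, [] => True
  | a :: s, b :: t => a < b ∨ a = b ∧ KB s t

theorem KB.irrefl : ∀ s, ¬ KB s s
  | [] => id
  | a :: s => by simpa [KB] using KB.irrefl s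

theorem KB.trans : ∀ {s t u : List ℕ}, KB s t → KB t u → KB s u
  | [], _, _, h, _ => h.elim
  | _ :: _, [], _, _, h => h.elim
  | _ :: _, _ :: _, [], _, _ => trivial
  | a :: s, b :: t, c :: u, h, h' => by
    rcases h with h | ⟨rfl, h⟩ <;> rcases h' with h' | ⟨rfl, h'⟩
    · exact .inl (h.trans h')
    · exact .inl h
    · exact .inl h'
    · exact .inr ⟨rfl, h.trans h'⟩

theorem KB.trichotomous : ∀ s t : List ℕ, s = t ∨ KB s t ∨ KB t s
  | [], [] => .inl rfl
  | _ :: _, [] => .inr (.inl trivial)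
  | [], _ :: _ => .inr (.inr trivial)
  | a :: s, b :: t => by
    rcases lt_trichotomy a b with h | rfl | h
    · exact .inr (.inl (.inl h))
    · rcases KB.trichotomous s t with rfl | h | h
      · exact .inl rfl
      · exact .inr (.inl (.inr ⟨rfl, h⟩))
      · exact .inr (.inr (.inr ⟨rfl, h⟩))
    · exact .inr (.inr (.inl h))

theorem KB.append_singleton : ∀ (s : List ℕ) (a : ℕ), KB (s ++ [a]) s
  | [], _ => trivial
  | _ :: s, a => .inr ⟨rfl, KB.append_singleton s a⟩

theorem KB.iff_exists : ∀ s t : List ℕ, KB s t ↔ ∃ i < s.length,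
    s.take i = t.take i ∧ (t.length ≤ i ∨ s.getD i 0 < t.getD i 0)
  | [], t => by simp [KB]
  | a :: s, [] => by simp [KB]
  | a :: s, b :: t => by
    rw [KB, KB.iff_exists s t]
    constructor
    · rintro (h | ⟨rfl, i, hi, h⟩)
      · exact ⟨0, by simp, by simp, .inr (by simpa using h)⟩
      · exact ⟨i + 1, by simpa using hi, by simpa using h⟩
    · rintro ⟨_ | i, hi, h, h'⟩
      · exact .inl (by simpa using h')
      · rw [List.take_succ_cons, List.take_succ_cons, List.cons.injEq] at h
        exact .inr ⟨h.1, i, by simpa using hi, h.2, by simpa using h'⟩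

theorem KB.primrecRel : PrimrecRel KB := by
  have hst : Primrec fun x : ℕ × List ℕ × List ℕ => x.2.1 := Primrec.fst.comp Primrec.snd
  have htt : Primrec fun x : ℕ × List ℕ × List ℕ => x.2.2 := Primrec.snd.comp Primrec.snd
  have hR : PrimrecRel fun (i : ℕ) (st : List ℕ × List ℕ) =>
      st.1.take i = st.2.take i ∧ (st.2.length ≤ i ∨ st.1.getD i 0 < st.2.getD i 0) :=
    (Primrec.eq.comp (Primrec.list_take.comp Primrec.fst hst)
      (Primrec.list_take.comp Primrec.fst htt)).and
      ((Primrec.nat_le.comp (Primrec.list_length.comp htt) Primrec.fst).or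
        (Primrec.nat_lt.comp ((Primrec.list_getD 0).comp hst Primrec.fst)
          ((Primrec.list_getD 0).comp htt Primrec.fst)))
  exact (hR.exists_mem_list.comp
    (Primrec.list_range.comp (Primrec.list_length.comp Primrec.fst)) Primrec.id).of_eq
    fun st => by simp [KB.iff_exists]

/-- Descending sequences for the Kleene–Brouwer order. -/
def KBDesc (d : ℕ → List ℕ) : Prop := ∀ i, KB (d (i + 1)) (d i)

theorem KBDesc.exists_tails {d : ℕ → List ℕ} (hd : KBDesc d) :
    ∃ a d', KBDesc d' ∧ (∀ i, ∃ j, d j = a :: d' i) ∧ a ≤ (d 1).headI := by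
  have hcons : ∀ i, d (i + 1) = (d (i + 1)).headI :: (d (i + 1)).tail := by
    intro i
    have := hd i
    generalize d (i + 1) = s at this
    cases s with
    | nil => exact this.elim
    | cons a s => rfl
  have hstep : ∀ i, (d (i + 2)).headI < (d (i + 1)).headI ∨
      (d (i + 2)).headI = (d (i + 1)).headI ∧ KB (d (i + 2)).tail (d (i + 1)).tail := by
    intro i
    have := hd (i + 1)
    rwa [hcons i, hcons (i + 1), KB] at this
  have hanti : Antitone fun i => (d (i + 1)).headI :=
    antitone_nat_of_succ_le fun i => (hstep i).elim le_of_lt fun h => h.1.le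
  obtain ⟨N, hN⟩ := WellFoundedLT.antitone_chain_condition hanti
  have hconst : ∀ i, (d (N + i + 1)).headI = (d (N + 1)).headI :=
    fun i => (hN _ (Nat.le_add_right N i)).symm
  refine ⟨(d (N + 1)).headI, fun i => (d (N + i + 1)).tail, fun i => ?_, fun i => ?_,
    hanti (Nat.zero_le N)⟩
  · have h1 := hconst i
    have h2 := hconst (i + 1)
    rcases hstep (N + i) with h | h
    · exact absurd (h2.trans h1.symm) h.ne
    · exact h.2
  · exact ⟨N + i + 1, (hcons (N + i)).trans (by rw [hconst])⟩

/-- The members of a Kleene–Brouwer descending sequence converge to an infinite sequence whose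
first value is bounded by the head of the second member. -/
theorem KBDesc.exists_limit {d : ℕ → List ℕ} (hd : KBDesc d) :
    ∃ f : ℕ → ℕ, f 0 ≤ (d 1).headI ∧ ∀ k, ∃ j, (List.range k).map f <+: d j := by
  choose a d' hd' hsub ha using fun e : {d : ℕ → List ℕ // KBDesc d} => e.2.exists_tails
  let E : ℕ → {d : ℕ → List ℕ // KBDesc d} :=
    fun k => Nat.rec ⟨d, hd⟩ (fun _ e => ⟨d' e, hd' e⟩) k
  refine ⟨fun k => a (E k), ha (E 0), fun k => ?_⟩
  have h : ∀ k i, ∃ j, d j = (List.range k).map (fun k => a (E k)) ++ (E k).1 i := by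
    intro k
    induction k with
    | zero => exact fun i => ⟨i, rfl⟩
    | succ k ih =>
      intro i
      obtain ⟨i', hi'⟩ := hsub (E k) i
      obtain ⟨j, hj⟩ := ih i'
      refine ⟨j, hj.trans ?_⟩
      rw [hi', List.range_succ, List.map_append, List.append_assoc]
      rfl
  obtain ⟨j, hj⟩ := h k 0
  exact ⟨j, _, hj.symm⟩

/-! ### From descending sequences to bounds -/

/-- The tree of attempts to verify an element of `sigmaU n`: the first entry is a candidate element
and every later entry is a pair consisting of a value of the witness and a running time of the
verification of the witness up to that value. -/
def witnessTree (n : ℕ) : Set (List ℕ) :=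
  {l | ∀ j < l.length, j = 0 ∨
    Code.evaln (l.getD j 0).unpair.2 (Denumerable.ofNat Code n)
      (Nat.pair l.headI
        (Encodable.encode ((l.take j).tail.map fun x => x.unpair.1))) = some 1}

theorem primrecRel_witnessTree : PrimrecRel fun (n : ℕ) (l : List ℕ) => l ∈ witnessTree n := by
  have hl : Primrec fun x : ℕ × ℕ × List ℕ => x.2.2 := Primrec.snd.comp Primrec.snd
  have hR : PrimrecRel fun (j : ℕ) (p : ℕ × List ℕ) => j = 0 ∨
      Code.evaln (p.2.getD j 0).unpair.2 (Denumerable.ofNat Code p.1)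
        (Nat.pair p.2.headI
          (Encodable.encode ((p.2.take j).tail.map fun x => x.unpair.1))) = some 1 := by
    refine (Primrec.eq.comp Primrec.fst (Primrec.const 0)).or
      (Primrec.eq.comp (Nat.Partrec.Code.primrec_evaln.comp (Primrec.pair (Primrec.pair ?_ ?_) ?_))
        (Primrec.const (some 1)))
    · exact Primrec.snd.comp (Primrec.unpair.comp ((Primrec.list_getD 0).comp hl Primrec.fst))
    · exact (Primrec.ofNat Code).comp (Primrec.fst.comp Primrec.snd)
    · exact Primrec₂.natPair.comp (Primrec.list_headI.comp hl) (Primrec.encode.comp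
        (Primrec.list_map (Primrec.list_tail.comp (Primrec.list_take.comp Primrec.fst hl))
          (Primrec.fst.comp (Primrec.unpair.comp Primrec.snd)).to₂))
  exact (hR.forall_mem_list.comp
    (Primrec.list_range.comp (Primrec.list_length.comp Primrec.snd)) Primrec.id).of_eq
    fun x => by simp [witnessTree]

/-- The verification carried out along an initial segment of an infinite sequence. -/
theorem eval_of_prefix_mem_witnessTree {n k : ℕ} {f : ℕ → ℕ} {l : List ℕ} (hl : l ∈ witnessTree n)
    (hf : (List.range (k + 2)).map f <+: l) :
    Code.evaln (f (k + 1)).unpair.2 (Denumerable.ofNat Code n)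
      (Nat.pair (f 0) (Encodable.encode ((List.range k).map fun i => (f (i + 1)).unpair.1))) =
        some 1 := by
  obtain ⟨r, rfl⟩ := hf
  have h := (hl (k + 1) (by simp; omega)).resolve_left (by simp)
  have h0 : ((List.range (k + 2)).map f ++ r).headI = f 0 := by
    simp [List.range_succ_eq_map]
  have h1 : ((List.range (k + 2)).map f ++ r).getD (k + 1) 0 = f (k + 1) := by
    simp [List.getD_eq_getElem?_getD, List.getElem?_append]
  have h2 : (((List.range (k + 2)).map f ++ r).take (k + 1)).tail =
      (List.range k).map fun i => f (i + 1) := by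
    rw [List.take_append_of_le_length (by simp), ← List.map_take, List.take_range]
    simp [List.range_succ_eq_map, Function.comp_def]
  rw [h0, h1, h2, List.map_map] at h
  exact h

theorem witnessTree_path_mem_sigmaU {n : ℕ} {f : ℕ → ℕ}
    (hf : ∀ k, ∃ l ∈ witnessTree n, (List.range k).map f <+: l) : f 0 ∈ sigmaU n := by
  refine ⟨fun i => (f (i + 1)).unpair.1, fun k => ?_⟩
  obtain ⟨l, hl, hfl⟩ := hf (k + 2)
  exact Part.eq_some_iff.2 (Nat.Partrec.Code.evaln_sound (eval_of_prefix_mem_witnessTree hl hfl))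

theorem exists_path_witnessTree {n : ℕ} (hn : (sigmaU n).Nonempty) :
    ∃ f, IsPath (witnessTree n) f := by
  obtain ⟨m, w, hw⟩ := hn
  choose t ht using fun k =>
    Nat.Partrec.Code.evaln_complete.1 (Part.eq_some_iff.1 (hw k))
  let f : ℕ → ℕ := fun i => Nat.casesOn i m fun i => Nat.pair (w i) (t i)
  refine ⟨f, fun k j hj => ?_⟩
  rw [List.length_map, List.length_range] at hj
  rcases j with _ | j
  · exact .inl rfl
  right
  obtain ⟨k, rfl⟩ := Nat.exists_eq_add_of_lt hj
  have h0 : ((List.range (j + 1 + k + 1)).map f).headI = m := by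
    simp [List.range_succ_eq_map, f]
  have h1 : ((List.range (j + 1 + k + 1)).map f).getD (j + 1) 0 = Nat.pair (w j) (t j) := by
    rw [List.getD_eq_getElem?_getD, List.getElem?_map, List.getElem?_range hj]
    rfl
  have h2 : (((List.range (j + 1 + k + 1)).map f).take (j + 1)).tail =
      (List.range j).map fun i => Nat.pair (w i) (t i) := by
    rw [← List.map_take, List.take_range, min_eq_left (by omega)]
    simp [List.range_succ_eq_map, Function.comp_def, f]
  rw [h0, h1, h2, List.map_map]
  simpa [Function.comp_def] using ht j

/-- The Kleene–Brouwer order on a set of finite sequences, on codes. -/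
def kbOrd (T : Set (List ℕ)) : LinOrd where
  dom := {x | Denumerable.ofNat (List ℕ) x ∈ T}
  lt x y := (Denumerable.ofNat (List ℕ) x ∈ T ∧ Denumerable.ofNat (List ℕ) y ∈ T) ∧
    KB (Denumerable.ofNat (List ℕ) x) (Denumerable.ofNat (List ℕ) y)

theorem kbOrd_isValid (T : Set (List ℕ)) : (kbOrd T).IsValid := by
  refine ⟨fun a b h => h.1, fun a h => KB.irrefl _ h.2,
    fun a b c h h' => ⟨⟨h.1.1, h'.1.2⟩, h.2.trans h'.2⟩, fun a ha b hb => ?_⟩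
  rcases KB.trichotomous (Denumerable.ofNat (List ℕ) a) (Denumerable.ofNat (List ℕ) b)
    with h | h | h
  · exact .inl (by simpa using congrArg Encodable.encode h)
  · exact .inr (.inl ⟨⟨ha, hb⟩, h⟩)
  · exact .inr (.inr ⟨⟨hb, ha⟩, h⟩)

theorem kbOrd_illFounded_of_isPath {T : Set (List ℕ)} {f : ℕ → ℕ} (hf : IsPath T f) :
    (kbOrd T).IllFounded := by
  refine ⟨fun k => Encodable.encode ((List.range k).map f), fun k => ⟨?_, ⟨?_, ?_⟩, ?_⟩⟩
  · simpa [kbOrd] using hf k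
  · simpa using hf (k + 1)
  · simpa using hf k
  · simpa [List.range_succ] using KB.append_singleton ((List.range k).map f) (f k)

/-- The Kleene–Brouwer orders of the witness trees are uniformly computable. -/
theorem exists_linOrdAt_eq_kbOrd_witnessTree :
    ∃ r : ℕ → ℕ, Primrec r ∧ ∀ n, linOrdAt (r n) = kbOrd (witnessTree n) := by
  have hof : Primrec (Denumerable.ofNat (List ℕ)) := Primrec.ofNat _
  have hdom : PrimrecRel fun n x : ℕ => x ∈ (kbOrd (witnessTree n)).dom :=
    primrecRel_witnessTree.comp Primrec.fst (hof.comp Primrec.snd)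
  have hx : Primrec fun p : ℕ × ℕ => Denumerable.ofNat (List ℕ) p.2.unpair.1 :=
    hof.comp (Primrec.fst.comp (Primrec.unpair.comp Primrec.snd))
  have hy : Primrec fun p : ℕ × ℕ => Denumerable.ofNat (List ℕ) p.2.unpair.2 :=
    hof.comp (Primrec.snd.comp (Primrec.unpair.comp Primrec.snd))
  have hlt : PrimrecRel fun n z : ℕ => (kbOrd (witnessTree n)).lt z.unpair.1 z.unpair.2 :=
    ((primrecRel_witnessTree.comp Primrec.fst hx).and
      (primrecRel_witnessTree.comp Primrec.fst hy)).and (KB.primrecRel.comp hx hy)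
  obtain ⟨q₁, hq₁, hd₁, h₁⟩ := exists_primrec_index_of_primrecRel hdom
  obtain ⟨q₂, hq₂, hd₂, h₂⟩ := exists_primrec_index_of_primrecRel hlt
  refine ⟨fun n => Nat.pair (q₁ n) (q₂ n), Primrec₂.natPair.comp hq₁ hq₂, fun n => ?_⟩
  have heq : linOrdOfCodes (Nat.pair (q₁ n) (q₂ n)) = kbOrd (witnessTree n) := by
    simp only [linOrdOfCodes, Nat.unpair_pair, h₁, h₂]
    rfl
  have hdec : DecidesLinOrd (Nat.pair (q₁ n) (q₂ n)) := by
    refine ⟨?_, ?_, heq ▸ kbOrd_isValid _⟩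
    · simpa using hd₁ n
    · simpa using hd₂ n
  rw [hdec.linOrdAt_eq, heq]

theorem exists_boundsMinima_of_loqHighForDS {X : Set ℕ} (hX : LoqHighForDS X) :
    ∃ h : ℕ → ℕ, ComputableIn (chi X) h ∧ BoundsMinima h := by
  obtain ⟨g, hg, hgd⟩ := hX
  obtain ⟨r, hr, hrK⟩ := exists_linOrdAt_eq_kbOrd_witnessTree
  refine ⟨fun n => (Denumerable.ofNat (List ℕ) (g (r n, 1))).headI, ?_, fun n hn => ?_⟩
  · rw [← totalRec_iff_computableIn]
    have hpair : Primrec fun n => Nat.pair (r n) 1 := Primrec₂.natPair.comp hr (Primrec.const 1)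
    simpa using (TotalRec.of_primrec (Primrec.list_headI.comp (Primrec.ofNat (List ℕ)))).comp
      ((totalRec_iff_computableIn_uncurried.2 hg).comp (.of_primrec hpair))
  · obtain ⟨p, hp⟩ := exists_path_witnessTree hn
    have hdesc := hgd (r n)
    rw [hrK] at hdesc
    replace hdesc := hdesc (kbOrd_illFounded_of_isPath hp)
    have hkb : KBDesc fun i => Denumerable.ofNat (List ℕ) (g (r n, i)) := fun i => (hdesc i).2.2
    obtain ⟨f, hf0, hf⟩ := hkb.exists_limit
    refine (Nat.sInf_le (witnessTree_path_mem_sigmaU fun k => ?_)).trans hf0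
    obtain ⟨j, hj⟩ := hf k
    exact ⟨_, (hdesc j).1, hj⟩

/-- `X` is loquaciously high for descending sequences iff some total
`X`-computable `h` satisfies `h n ≥ min (sigmaU n)` whenever `sigmaU n` is nonempty. -/
theorem loqHighForDS_iff_dominates_min_Sigma11 (X : Set ℕ) :
    LoqHighForDS X ↔
      ∃ h : ℕ → ℕ, ComputableIn (chi X) h ∧
        ∀ n, (sigmaU n).Nonempty → sInf (sigmaU n) ≤ h n := by
  exact ⟨exists_boundsMinima_of_loqHighForDS,
    fun ⟨_, hh, hb⟩ => loqHighForDS_of_boundsMinima hh hb⟩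

end CFT
end
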